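/- Let α be a linear order and let s, t, b₁, b₂ : Set α be ord-connected sets with Disjoint s t and Disjoint b₁ b₂. Then it is impossible that b₁ meets both s and t and b₂ also meets both s and t; i.e. if (b₁ ∩ s).Nonempty, (b₁ ∩ t).Nonempty, (b₂ ∩ s).Nonempty, and (b₂ ∩ t).Nonempty, then False. Equivalently, at most one member of any family of pairwise disjoint intervals can intersect both of two fixed disjoint intervals. -/

import Mathlib

/-- If one point of `s` lies below one point of `t`, all points of `s` lie below all of `t`. -/
theorem lt_of_disjoint_intervals {α : Type*} [LinearOrder α] {s t : Set α}
    (hs : s.OrdConnected) (ht : t.OrdConnected) (hst : Disjoint s t) {x x' y y' : α}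
    (hx : x ∈ s) (hx' : x' ∈ s) (hy : y ∈ t) (hy' : y' ∈ t) (h : x < y) : x' < y' := by
  by_contra hn
  have hn := not_lt.mp hn
  rcases le_or_gt y' x with h1 | h1
  · exact Set.disjoint_left.mp hst hx (ht.out hy' hy ⟨h1, h.le⟩)
  · exact Set.disjoint_left.mp hst (hs.out hx hx' ⟨h1.le, hn⟩) hy'

/-- Two disjoint ord-connected sets `b₁, b₂` cannot both meet each of two
disjoint ord-connected sets `s, t`. -/
theorem not_both_meet_disjoint_intervals {α : Type*} [LinearOrder α]
    (s t b₁ b₂ : Set α)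
    (hs : s.OrdConnected) (ht : t.OrdConnected)
    (hb₁ : b₁.OrdConnected) (hb₂ : b₂.OrdConnected)
    (hst : Disjoint s t) (hb : Disjoint b₁ b₂)
    (h1s : (b₁ ∩ s).Nonempty) (h1t : (b₁ ∩ t).Nonempty)
    (h2s : (b₂ ∩ s).Nonempty) (h2t : (b₂ ∩ t).Nonempty) : False := by
  obtain ⟨a, ha1, has⟩ := h1s
  obtain ⟨b, hb1, hbt⟩ := h1t
  obtain ⟨c, hc2, hcs⟩ := h2s
  obtain ⟨d, hd2, hdt⟩ := h2t
  have key1 := @lt_of_disjoint_intervals α _ s t hs ht hst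
  have key2 := @lt_of_disjoint_intervals α _ t s ht hs hst.symm
  have key3 := @lt_of_disjoint_intervals α _ b₁ b₂ hb₁ hb₂ hb
  have key4 := @lt_of_disjoint_intervals α _ b₂ b₁ hb₂ hb₁ hb.symm
  have hab : a ≠ b := fun e => Set.disjoint_left.mp hst has (e ▸ hbt)
  have hac : a ≠ c := fun e => Set.disjoint_left.mp hb ha1 (e ▸ hc2)
  rcases lt_or_gt_of_ne hab with h | h <;> rcases lt_or_gt_of_ne hac with h' | h'
  · exact lt_asymm (key1 has hcs hbt hbt h) (key3 ha1 hb1 hc2 hc2 h')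
  · exact lt_asymm (key1 has has hbt hdt h) (key4 hc2 hd2 ha1 ha1 h')
  · exact lt_asymm (key2 hbt hdt has has h) (key3 ha1 ha1 hc2 hd2 h')
  · exact lt_asymm (key2 hbt hbt has hcs h) (key4 hc2 hc2 ha1 hb1 h')
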